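/- Let R be a coherent commutative ring and M a finitely presented R-module with finite Gorenstein projective dimension n > 0. Then there exists a short exact sequence 0 → K → G → M → 0 of R-modules where G is finitely generated Gorenstein projective and K is finitely presented with pd_R(K) = n − 1. -/

import Mathlib

open CategoryTheory

noncomputable section

namespace GW

variable (R : Type) [CommRing R]

/-- `M` is a Gorenstein projective module: there is a doubly infinite exact sequence of
projective modules, remaining exact under `Hom(-, Q)` for every projective `Q`, with `M`
isomorphic to one of its kernels (equivalently, images). -/
def IsGProj (M : ModuleCat.{0} R) : Prop :=
  ∃ (P : ℤ → ModuleCat.{0} R) (d : ∀ i, P i →ₗ[R] P (i + 1)),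
    (∀ i, Module.Projective R (P i)) ∧
    (∀ i, Function.Exact (d i) (d (i + 1))) ∧
    (∀ (Q : ModuleCat.{0} R), Module.Projective R Q →
      ∀ i, Function.Exact
        (fun g : P (i + 1 + 1) →ₗ[R] Q => g.comp (d (i + 1)))
        (fun g : P (i + 1) →ₗ[R] Q => g.comp (d i))) ∧
    Nonempty (M ≃ₗ[R] LinearMap.ker (d 0))

/-- `M` is a strongly Gorenstein projective module. -/
def IsSGProj (M : ModuleCat.{0} R) : Prop :=
  ∃ (P : ModuleCat.{0} R) (f : P →ₗ[R] P),
    Module.Projective R P ∧ Function.Exact f f ∧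
    (∀ (Q : ModuleCat.{0} R), Module.Projective R Q →
      Function.Exact (fun g : P →ₗ[R] Q => g.comp f) (fun g : P →ₗ[R] Q => g.comp f)) ∧
    Nonempty (M ≃ₗ[R] LinearMap.range f)

/-- Gorenstein projective dimension at most `n`, via resolutions by Gorenstein projectives. -/
def gpdLE : ℕ → ModuleCat.{0} R → Prop
  | 0, M => IsGProj R M
  | (n + 1), M => ∃ (K G : ModuleCat.{0} R) (f : K →ₗ[R] G) (g : G →ₗ[R] M),
      IsGProj R G ∧ Function.Injective f ∧ Function.Surjective g ∧
      Function.Exact f g ∧ gpdLE n K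

/-- Gorenstein projective dimension, valued in `ℕ∞`. -/
def gpd (M : ModuleCat.{0} R) : ℕ∞ := ⨅ (n : ℕ) (_ : gpdLE R n M), (n : ℕ∞)

/-- `M` is a Gorenstein flat module. -/
def IsGFlat (M : ModuleCat.{0} R) : Prop :=
  ∃ (F : ℤ → ModuleCat.{0} R) (d : ∀ i, F i →ₗ[R] F (i + 1)),
    (∀ i, Module.Flat R (F i)) ∧
    (∀ i, Function.Exact (d i) (d (i + 1))) ∧
    (∀ (I : ModuleCat.{0} R), Module.Injective R I →
      ∀ i, Function.Exact (LinearMap.lTensor I (d i)) (LinearMap.lTensor I (d (i + 1)))) ∧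
    Nonempty (M ≃ₗ[R] LinearMap.ker (d 0))

/-- Gorenstein flat dimension at most `n`. -/
def gfdLE : ℕ → ModuleCat.{0} R → Prop
  | 0, M => IsGFlat R M
  | (n + 1), M => ∃ (K G : ModuleCat.{0} R) (f : K →ₗ[R] G) (g : G →ₗ[R] M),
      IsGFlat R G ∧ Function.Injective f ∧ Function.Surjective g ∧
      Function.Exact f g ∧ gfdLE n K

/-- Gorenstein flat dimension, valued in `ℕ∞`. -/
def gfd (M : ModuleCat.{0} R) : ℕ∞ := ⨅ (n : ℕ) (_ : gfdLE R n M), (n : ℕ∞)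

/-- The Gorenstein weak dimension of `R`: the supremum of Gorenstein flat dimensions. -/
def gwdim : ℕ∞ := ⨆ M : ModuleCat.{0} R, gfd R M

/-- Projective dimension at most `n`. -/
def pdLE : ℕ → ModuleCat.{0} R → Prop
  | 0, M => Module.Projective R M
  | (n + 1), M => ∃ (K G : ModuleCat.{0} R) (f : K →ₗ[R] G) (g : G →ₗ[R] M),
      Module.Projective R G ∧ Function.Injective f ∧ Function.Surjective g ∧
      Function.Exact f g ∧ pdLE n K

/-- Projective dimension, valued in `ℕ∞`. -/
def pd (M : ModuleCat.{0} R) : ℕ∞ := ⨅ (n : ℕ) (_ : pdLE R n M), (n : ℕ∞)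

/-- Flat dimension at most `n`. -/
def fdLE : ℕ → ModuleCat.{0} R → Prop
  | 0, M => Module.Flat R M
  | (n + 1), M => ∃ (K G : ModuleCat.{0} R) (f : K →ₗ[R] G) (g : G →ₗ[R] M),
      Module.Flat R G ∧ Function.Injective f ∧ Function.Surjective g ∧
      Function.Exact f g ∧ fdLE n K

/-- Flat dimension, valued in `ℕ∞`. -/
def fd (M : ModuleCat.{0} R) : ℕ∞ := ⨅ (n : ℕ) (_ : fdLE R n M), (n : ℕ∞)

/-- A coherent ring: every finitely generated ideal is finitely presented. -/
def IsCoherentRing : Prop := ∀ I : Ideal R, I.FG → Module.FinitePresentation R I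

/-- `Ext^n_R(M, N)` as a module. -/
def extGrp (n : ℕ) (M N : ModuleCat.{0} R) : ModuleCat R :=
  ((Ext R (ModuleCat.{0} R) n).obj (Opposite.op M)).obj N

/-- `Tor_n^R(M, N)`. -/
def torGrp (n : ℕ) (M N : ModuleCat.{0} R) : ModuleCat.{0} R :=
  ((Tor (ModuleCat.{0} R) n).obj M).obj N

/-- The Gorenstein global dimension of `R` (the common value of the suprema of Gorenstein
projective and Gorenstein injective dimensions), here the supremum of `Gpd`. -/
def ggldim : ℕ∞ := ⨆ M : ModuleCat.{0} R, gpd R M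

/-- `M` admits a finite resolution of length `n` by finitely generated projective modules. -/
def finFGRes : ℕ → ModuleCat.{0} R → Prop
  | 0, M => Module.Projective R M ∧ Module.Finite R M
  | (n + 1), M => ∃ (K G : ModuleCat.{0} R) (f : K →ₗ[R] G) (g : G →ₗ[R] M),
      Module.Projective R G ∧ Module.Finite R G ∧ Function.Injective f ∧
      Function.Surjective g ∧ Function.Exact f g ∧ finFGRes n K

/-- The small finitistic projective dimension of `R`. -/
def fPD : ℕ∞ :=
  ⨆ (M : ModuleCat.{0} R) (_ : (∃ n, finFGRes R n M) ∧ pd R M ≠ ⊤), pd R M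

/-- The small finitistic Gorenstein projective dimension of `R`. -/
def fGPD : ℕ∞ :=
  ⨆ (M : ModuleCat.{0} R) (_ : (∃ n, finFGRes R n M) ∧ gpd R M ≠ ⊤), gpd R M

/-- An arithmetical ring: every finitely generated ideal is locally principal. -/
def IsArithmetical : Prop :=
  ∀ I : Ideal R, I.FG → ∀ (p : Ideal R) (hp : p.IsMaximal),
    haveI := hp.isPrime
    (I.map (algebraMap R (Localization.AtPrime p))).IsPrincipal

/-- A quasi-Frobenius ring: Noetherian and self-injective. -/
def IsQuasiFrobenius : Prop := IsNoetherianRing R ∧ Module.Injective R R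

/-- The submodule `X • N` of a module `N` over a power series ring. -/
def Xsub {R : Type} [CommRing R] (N : ModuleCat.{0} (PowerSeries R)) :
    Submodule (PowerSeries R) N :=
  LinearMap.range (LinearMap.lsmul (PowerSeries R) N PowerSeries.X)

lemma Xsub_le {R : Type} [CommRing R] {N N' : ModuleCat.{0} (PowerSeries R)}
    (f : N →ₗ[PowerSeries R] N') : Xsub N ≤ (Xsub N').comap f := by
  rintro x ⟨k, rfl⟩
  exact ⟨f k, (map_smul f _ _).symm⟩

/-- The induced map `N/XN → N'/XN'`. -/
def qmap {R : Type} [CommRing R] {N N' : ModuleCat.{0} (PowerSeries R)}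
    (f : N →ₗ[PowerSeries R] N') :
    (N ⧸ Xsub N) →ₗ[PowerSeries R] (N' ⧸ Xsub N') :=
  Submodule.mapQ _ _ f (Xsub_le f)

end GW

namespace GW

structure Ses {R : Type} [CommRing R] {A B C : ModuleCat.{0} R} (f : A →ₗ[R] B)
    (g : B →ₗ[R] C) : Prop where
  inj : Function.Injective f
  surj : Function.Surjective g
  exact : Function.Exact f g

/-- all higher `Ext` into projectives vanish -/
def EV {R : Type} [CommRing R] (A : ModuleCat.{0} R) : Prop :=
  ∀ (Q : ModuleCat.{0} R), Module.Projective R Q →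
    ∀ (n : ℕ) (x : Abelian.Ext A Q (n + 1)), x = 0

section
variable {R : Type} [CommRing R] {A B C : ModuleCat.{0} R} {f : A →ₗ[R] B} {g : B →ₗ[R] C}

theorem Ses.sexact (h : Ses f g) :
    (ShortComplex.mk (ModuleCat.ofHom f) (ModuleCat.ofHom g)
      (by ext x; exact h.exact.apply_apply_eq_zero x)).ShortExact :=
  ModuleCat.shortComplex_shortExact _ h.exact h.inj h.surj

theorem EV_of_proj (h : Module.Projective R A) : EV A := by
  intro Q hQ n x
  exact x.eq_zero_of_projective

theorem Ses.EV_left (h : Ses f g) (hB : EV B) (hC : EV C) : EV A := by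
  intro Q hQ n x
  obtain ⟨y, hy⟩ := Abelian.Ext.contravariant_sequence_exact₁ h.sexact Q x (n₁ := n + 1 + 1) (by omega)
    (hC Q hQ _ _)
  rw [← hy, hB Q hQ n y, Abelian.Ext.comp_zero]

theorem Ses.EV_mid (h : Ses f g) (hA : EV A) (hC : EV C) : EV B := by
  intro Q hQ n x
  obtain ⟨y, hy⟩ := Abelian.Ext.contravariant_sequence_exact₂ h.sexact Q x (hA Q hQ n _)
  rw [← hy, hC Q hQ n y, Abelian.Ext.comp_zero]

/-- `Ext¹(C,Q) = 0` gives extension of maps. -/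
theorem Ses.extend (h : Ses f g) {Q : ModuleCat.{0} R}
    (hC : ∀ x : Abelian.Ext C Q 1, x = 0) (u : A →ₗ[R] Q) :
    ∃ v : B →ₗ[R] Q, v.comp f = u := by
  obtain ⟨y, hy⟩ := Abelian.Ext.contravariant_sequence_exact₁ h.sexact Q
    (Abelian.Ext.mk₀ (ModuleCat.ofHom u)) (by rfl) (hC _)
  obtain ⟨v, rfl⟩ := (Abelian.Ext.mk₀_bijective _ _).2 y
  rw [Abelian.Ext.mk₀_comp_mk₀] at hy
  have := (Abelian.Ext.mk₀_bijective _ _).1 hy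
  exact ⟨v.hom, by simpa using congrArg ModuleCat.Hom.hom this⟩

theorem Ses.ext1 (h : Ses f g) (hB : Module.Projective R B) {Q : ModuleCat.{0} R}
    (hA : ∀ u : A →ₗ[R] Q, ∃ v : B →ₗ[R] Q, v.comp f = u) (x : Abelian.Ext C Q 1) : x = 0 := by
  obtain ⟨y, hy⟩ := Abelian.Ext.contravariant_sequence_exact₃ h.sexact Q x
    (Abelian.Ext.eq_zero_of_projective _) (n₀ := 0) (by rfl)
  obtain ⟨u, rfl⟩ := (Abelian.Ext.mk₀_bijective _ _).2 y
  obtain ⟨v, hv⟩ := hA u.hom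
  have : u = ModuleCat.ofHom f ≫ ModuleCat.ofHom v := by
    ext x; simp [← hv]
  rw [← hy, this, ← Abelian.Ext.mk₀_comp_mk₀]
  exact h.sexact.extClass_comp_assoc _

theorem Ses.ext_succ (h : Ses f g) (hB : Module.Projective R B) {Q : ModuleCat.{0} R} (n : ℕ)
    (hA : ∀ x : Abelian.Ext A Q (n + 1), x = 0) (x : Abelian.Ext C Q (n + 1 + 1)) : x = 0 := by
  obtain ⟨y, hy⟩ := Abelian.Ext.contravariant_sequence_exact₃ h.sexact Q x
    (Abelian.Ext.eq_zero_of_projective _) (n₀ := n + 1) (by omega)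
  rw [← hy, hA y, Abelian.Ext.comp_zero]

theorem Ses.EV_right (h : Ses f g) (hB : Module.Projective R B) (hA : EV A)
    (hx : ∀ (Q : ModuleCat.{0} R), Module.Projective R Q →
      ∀ u : A →ₗ[R] Q, ∃ v : B →ₗ[R] Q, v.comp f = u) : EV C := by
  intro Q hQ n x
  cases n with
  | zero => exact h.ext1 hB (hx Q hQ) x
  | succ n => exact h.ext_succ hB n (hA Q hQ n) x

end

/-- coinductive Gorenstein projective -/
def GPc {R : Type} [CommRing R] (A : ModuleCat.{0} R) : Prop :=
  ∃ X : ModuleCat.{0} R → Prop, X A ∧ ∀ B, X B → EV B ∧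
    ∃ (P B' : ModuleCat.{0} R) (i : B →ₗ[R] P) (p : P →ₗ[R] B'),
      Module.Projective R P ∧ Ses i p ∧ X B'

section
variable {R : Type} [CommRing R] {A B C : ModuleCat.{0} R} {f : A →ₗ[R] B} {g : B →ₗ[R] C}

theorem GPc.ev (h : GPc A) : EV A := by
  obtain ⟨X, hA, hX⟩ := h
  exact (hX A hA).1

theorem GPc.step (h : GPc A) :
    ∃ (P B' : ModuleCat.{0} R) (i : A →ₗ[R] P) (p : P →ₗ[R] B'),
      Module.Projective R P ∧ Ses i p ∧ GPc B' := by
  obtain ⟨X, hA, hX⟩ := h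
  obtain ⟨P, B', i, p, h1, h2, h3⟩ := (hX A hA).2
  exact ⟨P, B', i, p, h1, h2, X, h3, hX⟩

/-- weak coinduction -/
theorem GPc.mk (hA : EV A) {P B' : ModuleCat.{0} R} {i : A →ₗ[R] P} {p : P →ₗ[R] B'}
    (hP : Module.Projective R P) (hs : Ses i p) (hB : GPc B') : GPc A := by
  refine ⟨fun B => B = A ∨ GPc B, Or.inl rfl, ?_⟩
  rintro B (rfl | hB)
  · exact ⟨hA, P, B', i, p, hP, hs, Or.inr hB⟩
  · obtain ⟨P, B', i, p, h1, h2, h3⟩ := hB.step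
    exact ⟨hB.ev, P, B', i, p, h1, h2, Or.inr h3⟩

theorem GPc.of_proj (hA : Module.Projective R A) : GPc A := by
  refine ⟨fun B => Module.Projective R B, hA, fun B hB => ⟨EV_of_proj hB, B, ModuleCat.of R PUnit, LinearMap.id, 0, hB, ⟨fun _ _ h => h, fun _ => ⟨0, rfl⟩, fun x => ?_⟩, ?_⟩⟩
  · simp
  · change Module.Projective R PUnit
    infer_instance

theorem GPc.extension (h : Ses f g) (hA : GPc A) (hC : GPc C) : GPc B := by
  refine ⟨fun B => ∃ (A C : ModuleCat.{0} R) (f : A →ₗ[R] B) (g : B →ₗ[R] C),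
    Ses f g ∧ GPc A ∧ GPc C, ⟨A, C, f, g, h, hA, hC⟩, ?_⟩
  clear h hA hC
  rintro B ⟨A, C, f, g, h, hA, hC⟩
  refine ⟨h.EV_mid hA.ev hC.ev, ?_⟩
  obtain ⟨P, A', i, p, hP, hs, hA'⟩ := hA.step
  obtain ⟨P', C', i', p', hP', hs', hC'⟩ := hC.step
  obtain ⟨v, hv⟩ := h.extend (hC.ev P hP 0) i
  have hv' : ∀ a, v (f a) = i a := fun a => congrArg (fun l => l a) hv
  let φ : B →ₗ[R] P × P' := v.prod (i'.comp g)
  let N := LinearMap.range φ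
  let a : A' →ₗ[R] (P × P') ⧸ N := 
    (LinearMap.ker p).liftQ (N.mkQ.comp (LinearMap.inl R P P')) (by
      intro x hx
      obtain ⟨y, rfl⟩ := (hs.exact x).1 hx
      simp only [LinearMap.mem_ker, LinearMap.comp_apply, Submodule.mkQ_apply,
        Submodule.Quotient.mk_eq_zero]
      refine ⟨f y, ?_⟩
      simp [φ, hv', h.exact.apply_apply_eq_zero]) ∘ₗ (p.quotKerEquivOfSurjective hs.surj).symm
  have ha : ∀ x, a (p x) = N.mkQ (x, 0) := by
    intro x
    have : (p.quotKerEquivOfSurjective hs.surj).symm (p x) = Submodule.Quotient.mk x := by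
      rw [LinearEquiv.symm_apply_eq]; rfl
    simp only [a, LinearMap.comp_apply, LinearEquiv.coe_coe]
    rw [this]; rfl
  let b : (P × P') ⧸ N →ₗ[R] C' := N.liftQ (p'.comp (LinearMap.snd R P P')) (by
    rintro _ ⟨y, rfl⟩
    simp [φ, hs'.exact.apply_apply_eq_zero])
  have hb : ∀ x y, b (N.mkQ (x, y)) = p' y := fun x y => rfl
  refine ⟨ModuleCat.of R (P × P'), ModuleCat.of R ((P × P') ⧸ N), φ, N.mkQ, ?_, ⟨?_, ?_, ?_⟩,
    A', C', a, b, ⟨?_, ?_, ?_⟩, hA', hC'⟩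
  · change Module.Projective R (P × P')
    infer_instance
  · rw [injective_iff_map_eq_zero]
    intro x hx
    have h1 : v x = 0 := congrArg Prod.fst hx
    have h2 : i' (g x) = 0 := congrArg Prod.snd hx
    have h3 : g x = 0 := hs'.inj (by simpa using h2)
    obtain ⟨y, rfl⟩ := (h.exact x).1 h3
    rw [hv'] at h1
    have : y = 0 := hs.inj (by simpa using h1)
    simp [this]
  · exact N.mkQ_surjective
  · intro x
    change N.mkQ x = 0 ↔ _
    rw [Submodule.mkQ_apply, Submodule.Quotient.mk_eq_zero]
    rfl
  · rw [injective_iff_map_eq_zero]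
    intro x hx
    obtain ⟨y, rfl⟩ := hs.surj x
    rw [ha, Submodule.mkQ_apply, Submodule.Quotient.mk_eq_zero] at hx
    obtain ⟨z, hz⟩ := hx
    have h1 : v z = y := congrArg Prod.fst hz
    have h2 : i' (g z) = 0 := congrArg Prod.snd hz
    have h3 : g z = 0 := hs'.inj (by simpa using h2)
    obtain ⟨w, rfl⟩ := (h.exact z).1 h3
    rw [← h1, hv', hs.exact.apply_apply_eq_zero]
  · intro c
    obtain ⟨y, rfl⟩ := hs'.surj c
    exact ⟨N.mkQ (0, y), hb 0 y⟩
  · intro x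
    obtain ⟨⟨x, y⟩, rfl⟩ := N.mkQ_surjective x
    constructor
    · intro hx
      rw [hb] at hx
      obtain ⟨c, rfl⟩ := (hs'.exact y).1 hx
      obtain ⟨z, rfl⟩ := h.surj c
      refine ⟨p (x - v z), ?_⟩
      rw [ha]
      rw [← sub_eq_zero, ← map_sub, Submodule.mkQ_apply, Submodule.Quotient.mk_eq_zero]
      exact ⟨-z, by simp [φ]⟩
    · rintro ⟨w, hw⟩
      obtain ⟨w, rfl⟩ := hs.surj w
      rw [ha] at hw
      rw [← hw, hb, map_zero]

theorem GPc.kernel (h : Ses f g) (hB : GPc B) (hC : GPc C) : GPc A := by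
  obtain ⟨P, B', i, p, hP, hs, hB'⟩ := hB.step
  let N := LinearMap.range (i.comp f)
  let a : C →ₗ[R] P ⧸ N := 
    (LinearMap.ker g).liftQ (N.mkQ.comp i) (by
      intro x hx
      obtain ⟨y, rfl⟩ := (h.exact x).1 hx
      simp only [LinearMap.mem_ker, LinearMap.comp_apply, Submodule.mkQ_apply,
        Submodule.Quotient.mk_eq_zero]
      exact ⟨y, rfl⟩) ∘ₗ (g.quotKerEquivOfSurjective h.surj).symm
  have ha : ∀ x, a (g x) = N.mkQ (i x) := by
    intro x
    have : (g.quotKerEquivOfSurjective h.surj).symm (g x) = Submodule.Quotient.mk x := by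
      rw [LinearEquiv.symm_apply_eq]; rfl
    simp only [a, LinearMap.comp_apply, LinearEquiv.coe_coe]
    rw [this]; rfl
  let b : P ⧸ N →ₗ[R] B' := N.liftQ p (by
    rintro _ ⟨y, rfl⟩
    simp [hs.exact.apply_apply_eq_zero])
  have hb : ∀ x, b (N.mkQ x) = p x := fun x => rfl
  have hs2 : Ses (A := C) (B := ModuleCat.of R (P ⧸ N)) (C := B') a b := by
    refine ⟨?_, ?_, ?_⟩
    · rw [injective_iff_map_eq_zero]
      intro x hx
      obtain ⟨y, rfl⟩ := h.surj x
      rw [ha, Submodule.mkQ_apply, Submodule.Quotient.mk_eq_zero] at hx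
      obtain ⟨z, hz⟩ := hx
      have := hs.inj hz
      rw [← this, h.exact.apply_apply_eq_zero]
    · intro x
      obtain ⟨y, rfl⟩ := hs.surj x
      exact ⟨N.mkQ y, rfl⟩
    · intro x
      obtain ⟨x, rfl⟩ := N.mkQ_surjective x
      constructor
      · intro hx
        rw [hb] at hx
        obtain ⟨c, rfl⟩ := (hs.exact x).1 hx
        exact ⟨g c, ha c⟩
      · rintro ⟨w, hw⟩
        obtain ⟨w, rfl⟩ := h.surj w
        rw [ha] at hw
        rw [← hw, hb, hs.exact.apply_apply_eq_zero]
  have hN := GPc.extension hs2 hC hB'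
  refine GPc.mk (h.EV_left hB.ev hC.ev) (P := P) (B' := ModuleCat.of R (P ⧸ N)) (i := i.comp f)
    (p := N.mkQ) hP ⟨hs.inj.comp h.inj, N.mkQ_surjective, fun x => ?_⟩ hN
  change N.mkQ x = 0 ↔ _
  rw [Submodule.mkQ_apply, Submodule.Quotient.mk_eq_zero]
  rfl

theorem ses_of_surj {B C : ModuleCat.{0} R} (g : B →ₗ[R] C) (hg : Function.Surjective g) :
    Ses (A := ModuleCat.of R (LinearMap.ker g)) (LinearMap.ker g).subtype g :=
  ⟨Subtype.val_injective, hg, fun x => by simp⟩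

theorem ses_of_inj {B C : ModuleCat.{0} R} (g : B →ₗ[R] C) (hg : Function.Injective g) :
    Ses (C := ModuleCat.of R (C ⧸ LinearMap.range g)) g (LinearMap.range g).mkQ :=
  ⟨hg, Submodule.mkQ_surjective _, fun x => by
    change (LinearMap.range g).mkQ x = 0 ↔ _
    rw [Submodule.mkQ_apply, Submodule.Quotient.mk_eq_zero]
    rfl⟩

theorem ses_prod (A B : ModuleCat.{0} R) :
    Ses (A := A) (B := ModuleCat.of R (A × B)) (C := B) (LinearMap.inl R A B)
      (LinearMap.snd R A B) :=
  ⟨LinearMap.inl_injective, LinearMap.snd_surjective, Function.Exact.inl_snd⟩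

theorem GPc.prod (hA : GPc A) (hB : GPc B) : GPc (ModuleCat.of R (A × B)) :=
  GPc.extension (ses_prod A B) hA hB

theorem GPc.of_equiv (hA : GPc A) (e : A ≃ₗ[R] B) : GPc B := by
  refine GPc.kernel (f := e.symm.toLinearMap) (C := ModuleCat.of R PUnit) (g := 0) ⟨e.symm.injective, fun _ => ⟨0, rfl⟩, fun x => ?_⟩ hA (GPc.of_proj ?_)
  · simp only [LinearMap.zero_apply, true_iff]
    exact ⟨e x, by simp⟩
  · change Module.Projective R PUnit
    infer_instance

theorem GPc.prev (hA : GPc A) : ∃ (L P : ModuleCat.{0} R) (i : L →ₗ[R] P) (p : P →ₗ[R] A),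
    Module.Projective R P ∧ Ses i p ∧ GPc L := by
  have hp : Module.Projective R (ModuleCat.of R (A →₀ R)) := by
    change Module.Projective R (A →₀ R)
    infer_instance
  have hs := ses_of_surj (B := ModuleCat.of R (A →₀ R)) (Finsupp.linearCombination R (id : A → A))
    (Finsupp.linearCombination_id_surjective R A)
  exact ⟨_, _, _, _, hp, hs, GPc.kernel hs (GPc.of_proj hp) hA⟩ 
end
end GW
namespace GW
section
variable {R : Type} [CommRing R]

theorem exists_factor {B C D : Type} [AddCommGroup B] [AddCommGroup C] [AddCommGroup D]
    [Module R B] [Module R C] [Module R D] (g : B →ₗ[R] C) (hg : Function.Surjective g)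
    (u : B →ₗ[R] D) (h : ∀ x, g x = 0 → u x = 0) : ∃ v : C →ₗ[R] D, ∀ x, v (g x) = u x := by
  refine ⟨(LinearMap.ker g).liftQ u (fun x hx => h x hx) ∘ₗ
    (g.quotKerEquivOfSurjective hg).symm, fun x => ?_⟩
  have : (g.quotKerEquivOfSurjective hg).symm (g x) = Submodule.Quotient.mk x := by
    rw [LinearEquiv.symm_apply_eq]; rfl
  simp only [LinearMap.comp_apply, LinearEquiv.coe_coe]
  rw [this]; rfl

theorem exists_colift {A B D : Type} [AddCommGroup A] [AddCommGroup B] [AddCommGroup D]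
    [Module R A] [Module R B] [Module R D] (f : A →ₗ[R] B) (hf : Function.Injective f)
    (u : D →ₗ[R] B) (h : ∀ x, ∃ y, f y = u x) : ∃ v : D →ₗ[R] A, ∀ x, f (v x) = u x := by
  refine ⟨(LinearEquiv.ofInjective f hf).symm.toLinearMap ∘ₗ
    u.codRestrict (LinearMap.range f) h, fun x => ?_⟩
  have := LinearEquiv.apply_symm_apply (LinearEquiv.ofInjective f hf)
    (u.codRestrict (LinearMap.range f) h x)
  exact congrArg Subtype.val this

theorem GPc_of_IsGProj {M : ModuleCat.{0} R} (hM : IsGProj R M) : GPc M := by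
  obtain ⟨P, d, hP, hd, hQ, ⟨e⟩⟩ := hM
  let Z : ℤ → ModuleCat.{0} R := fun i => ModuleCat.of R (LinearMap.ker (d i))
  let p : ∀ i, P i →ₗ[R] Z (i + 1) := fun i =>
    (d i).codRestrict (LinearMap.ker (d (i + 1))) (fun x => (hd i).apply_apply_eq_zero x)
  have hs : ∀ i, Ses (A := Z i) (C := Z (i + 1)) (LinearMap.ker (d i)).subtype (p i) := by
    intro i
    refine ⟨Subtype.val_injective, ?_, ?_⟩
    · rintro ⟨y, hy⟩
      obtain ⟨x, hx⟩ := (hd i y).1 hy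
      exact ⟨x, Subtype.ext hx⟩
    · intro x
      constructor
      · intro hx
        exact ⟨⟨x, congrArg Subtype.val hx⟩, rfl⟩
      · rintro ⟨⟨y, hy⟩, rfl⟩
        exact Subtype.ext hy
  have hext : ∀ (Q : ModuleCat.{0} R), Module.Projective R Q → ∀ i (u : Z i →ₗ[R] Q),
      ∃ v : P i →ₗ[R] Q, v.comp (LinearMap.ker (d i)).subtype = u := by
    intro Q hQp i
    obtain ⟨j, rfl⟩ : ∃ j, i = j + 1 + 1 := ⟨i - 1 - 1, by ring⟩
    intro u
    obtain ⟨v, hv⟩ := (hQ Q hQp j (u.comp (p (j + 1)))).1 (by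
      ext x
      have : p (j + 1) (d j x) = 0 := Subtype.ext ((hd j).apply_apply_eq_zero x)
      simp [this])
    refine ⟨v, ?_⟩
    ext z
    obtain ⟨x, rfl⟩ := (hs (j + 1)).surj z
    exact congrArg (fun l => l x) hv
  have hEV : ∀ (Q : ModuleCat.{0} R), Module.Projective R Q → ∀ (n : ℕ) (i : ℤ)
      (x : Abelian.Ext (Z i) Q (n + 1)), x = 0 := by
    intro Q hQp n
    induction n with
    | zero =>
      intro i
      obtain ⟨j, rfl⟩ : ∃ j, i = j + 1 := ⟨i - 1, by ring⟩
      exact (hs j).ext1 (hP j) (hext Q hQp j)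
    | succ n ih =>
      intro i
      obtain ⟨j, rfl⟩ : ∃ j, i = j + 1 := ⟨i - 1, by ring⟩
      exact (hs j).ext_succ (hP j) n (ih j)
  have hZ : GPc (Z 0) := by
    refine ⟨fun B => ∃ i, B = Z i, ⟨0, rfl⟩, ?_⟩
    rintro B ⟨i, rfl⟩
    exact ⟨fun Q hQp n x => hEV Q hQp n i x, P i, Z (i + 1), _, p i, hP i, hs i, i + 1, rfl⟩
  exact hZ.of_equiv e.symm

theorem GPc.isGProj {M : ModuleCat.{0} R} (hM : GPc M) : IsGProj R M := by
  let S := {A : ModuleCat.{0} R // GPc A}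
  have h1 : ∀ A : S, ∃ B : S, ∃ (P : ModuleCat.{0} R) (i : A.1 →ₗ[R] P) (p : P →ₗ[R] B.1),
      Module.Projective R P ∧ Ses i p := by
    rintro ⟨A, hA⟩
    obtain ⟨P, B, i, p, hP, hs, hB⟩ := hA.step
    exact ⟨⟨B, hB⟩, P, i, p, hP, hs⟩
  have h2 : ∀ A : S, ∃ B : S, ∃ (P : ModuleCat.{0} R) (i : B.1 →ₗ[R] P) (p : P →ₗ[R] A.1),
      Module.Projective R P ∧ Ses i p := by
    rintro ⟨A, hA⟩
    obtain ⟨B, P, i, p, hP, hs, hB⟩ := hA.prev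
    exact ⟨⟨B, hB⟩, P, i, p, hP, hs⟩
  choose nx hnx using h1
  choose pv hpv using h2
  let Z : ℤ → S := fun i => match i with
    | Int.ofNat n => nx^[n] ⟨M, hM⟩
    | Int.negSucc n => pv^[n + 1] ⟨M, hM⟩
  have hZ : ∀ i, ∃ (P : ModuleCat.{0} R) (ι : (Z i).1 →ₗ[R] P) (p : P →ₗ[R] (Z (i + 1)).1),
      Module.Projective R P ∧ Ses ι p := by
    intro i
    match i with
    | Int.ofNat n =>
      have e : Z (Int.ofNat n + 1) = nx (Z (Int.ofNat n)) := by
        rw [show Int.ofNat n + 1 = Int.ofNat (n + 1) from rfl]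
        exact Function.iterate_succ_apply' _ _ _
      rw [e]; exact hnx _
    | Int.negSucc 0 =>
      have e : Z (Int.negSucc 0) = pv (Z (Int.negSucc 0 + 1)) := rfl
      rw [e]; exact hpv _
    | Int.negSucc (n + 1) =>
      have e : Z (Int.negSucc (n + 1)) = pv (Z (Int.negSucc (n + 1) + 1)) := by
        rw [show Int.negSucc (n + 1) + 1 = Int.negSucc n from rfl]
        exact Function.iterate_succ_apply' _ _ _
      rw [e]; exact hpv _
  choose P ι p hP hs using hZ
  refine ⟨P, fun i => (ι (i + 1)).comp (p i), hP, ?_, ?_, ?_⟩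
  · intro i x
    simp only [LinearMap.comp_apply]
    constructor
    · intro hx
      have h3 : p (i + 1) x = 0 := (hs (i + 1 + 1)).inj (by rw [hx, map_zero])
      obtain ⟨y, rfl⟩ := ((hs (i + 1)).exact x).1 h3
      obtain ⟨z, rfl⟩ := (hs i).surj y
      exact ⟨z, rfl⟩
    · rintro ⟨y, rfl⟩
      simp [(hs (i + 1)).exact.apply_apply_eq_zero]
  · intro Q hQ i g
    constructor
    · intro hg
      have hg' : ∀ z, g (ι (i + 1) z) = 0 := by
        intro z
        obtain ⟨x, rfl⟩ := (hs i).surj z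
        exact congrArg (fun l => l x) hg
      obtain ⟨h, hh⟩ := exists_factor (p (i + 1)) (hs (i + 1)).surj g (by
        intro x hx
        obtain ⟨y, rfl⟩ := ((hs (i + 1)).exact x).1 hx
        exact hg' y)
      obtain ⟨v, hv⟩ := (hs (i + 1 + 1)).extend ((Z (i + 1 + 1 + 1)).2.ev Q hQ 0) h
      refine ⟨v, ?_⟩
      ext x
      have := congrArg (fun l => l (p (i + 1) x)) hv
      simp only [LinearMap.comp_apply] at this ⊢
      rw [this, hh]
    · rintro ⟨v, rfl⟩
      ext x
      simp [(hs (i + 1)).exact.apply_apply_eq_zero]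
  · have e1 : LinearMap.range (ι 0) = LinearMap.ker ((ι (0 + 1)).comp (p 0)) := by
      ext x
      rw [LinearMap.mem_ker, LinearMap.comp_apply, LinearMap.mem_range]
      rw [show (∃ y, ι 0 y = x) ↔ p 0 x = 0 from ((hs 0).exact x).symm]
      exact ⟨fun h => by rw [h, map_zero], fun h => (hs (0 + 1)).inj (by rw [h, map_zero])⟩
    exact ⟨(LinearEquiv.ofInjective (ι 0) (hs 0).inj).trans (LinearEquiv.ofEq _ _ e1)⟩

theorem isGProj_iff {M : ModuleCat.{0} R} : IsGProj R M ↔ GPc M :=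
  ⟨GPc_of_IsGProj, GPc.isGProj⟩

theorem third_iso {A B C F W : ModuleCat.{0} R} {f : A →ₗ[R] B} {g : B →ₗ[R] C}
    {i : F →ₗ[R] B} {r : B →ₗ[R] W} (h : Ses f g) (h' : Ses i r) (k : A →ₗ[R] F)
    (hk : ∀ x, i (k x) = f x) :
    ∃ (a : ModuleCat.of R (F ⧸ LinearMap.range k) →ₗ[R] C) (b : C →ₗ[R] W), Ses a b := by
  obtain ⟨a, ha⟩ := exists_factor (LinearMap.range k).mkQ (Submodule.mkQ_surjective _)
    (g.comp i) (by
      intro x hx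
      rw [Submodule.mkQ_apply, Submodule.Quotient.mk_eq_zero] at hx
      obtain ⟨y, rfl⟩ := hx
      simp [hk, h.exact.apply_apply_eq_zero])
  obtain ⟨b, hb⟩ := exists_factor g h.surj r (by
      intro x hx
      obtain ⟨y, rfl⟩ := (h.exact x).1 hx
      rw [← hk, h'.exact.apply_apply_eq_zero])
  simp only [LinearMap.comp_apply] at ha
  refine ⟨a, b, ⟨?_, ?_, ?_⟩⟩
  · rw [injective_iff_map_eq_zero]
    intro x hx
    obtain ⟨y, rfl⟩ := Submodule.mkQ_surjective _ x
    erw [ha] at hx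
    obtain ⟨z, hz⟩ := (h.exact _).1 hx
    rw [← hk] at hz
    have := h'.inj hz
    erw [Submodule.mkQ_apply, Submodule.Quotient.mk_eq_zero]
    exact ⟨z, this⟩
  · intro w
    obtain ⟨x, rfl⟩ := h'.surj w
    exact ⟨g x, hb x⟩
  · intro c
    obtain ⟨x, rfl⟩ := h.surj c
    rw [hb]
    constructor
    · intro hx
      obtain ⟨y, rfl⟩ := (h'.exact _).1 hx
      exact ⟨(LinearMap.range k).mkQ y, ha y⟩
    · rintro ⟨y, hy⟩
      obtain ⟨y, rfl⟩ := Submodule.mkQ_surjective _ y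
      erw [ha] at hy
      rw [← hb, ← hy, hb, h'.exact.apply_apply_eq_zero]

theorem GPc.step_free {G : ModuleCat.{0} R} (hG : GPc G) :
    ∃ (ι : Type) (C : ModuleCat.{0} R) (i : G →ₗ[R] ModuleCat.of R (ι →₀ R))
      (p : ModuleCat.of R (ι →₀ R) →ₗ[R] C), Ses i p ∧ GPc C := by
  obtain ⟨P, G1, i, p, hP, hs, hG1⟩ := hG.step
  obtain ⟨s, hsec⟩ := Module.projective_def.1 hP
  let lc : (P →₀ R) →ₗ[R] P := Finsupp.linearCombination R (id : P → P)
  have hsec : ∀ x, lc (s x) = x := hsec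
  let r : (P →₀ R) →ₗ[R] LinearMap.ker lc :=
    (LinearMap.id - s.comp lc).codRestrict _ (fun x => by simp [hsec])
  have hr : ∀ x, (r x : P →₀ R) = x - s (lc x) := fun x => rfl
  have hpr : Module.Projective R (LinearMap.ker lc) := by
    refine Module.Projective.of_split (LinearMap.ker lc).subtype r ?_
    ext1 x
    apply Subtype.ext
    simp [hr]
  refine ⟨P, ModuleCat.of R (G1 × ModuleCat.of R (LinearMap.ker lc)), s.comp i,
    (p.comp lc).prod r, ⟨?_, ?_, ?_⟩, GPc.prod hG1 (GPc.of_proj hpr)⟩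
  · exact (Function.LeftInverse.injective hsec).comp hs.inj
  · rintro ⟨a, k⟩
    obtain ⟨x, rfl⟩ := hs.surj a
    have hk : lc k = 0 := k.2
    refine ⟨s x + k, Prod.ext ?_ (Subtype.ext ?_)⟩
    · change p (lc (s x + k)) = _
      simp [hsec, hk]
    · change ((r (s x + k) : LinearMap.ker lc) : P →₀ R) = k
      simp [hr, hsec, hk]
  · intro x
    constructor
    · intro hx
      have h1 : p (lc x) = 0 := congrArg Prod.fst hx
      have h2 : r x = 0 := congrArg Prod.snd hx
      have h3 : x - s (lc x) = 0 := congrArg Subtype.val h2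
      obtain ⟨y, hy⟩ := (hs.exact _).1 h1
      refine ⟨y, ?_⟩
      rw [LinearMap.comp_apply, hy]
      exact (sub_eq_zero.1 h3).symm
    · rintro ⟨y, rfl⟩
      refine Prod.ext ?_ (Subtype.ext ?_)
      · change p (lc (s (i y))) = 0
        rw [hsec, hs.exact.apply_apply_eq_zero]
      · change s (i y) - s (lc (s (i y))) = 0
        simp [hsec]

theorem GPc.step_fin {G : ModuleCat.{0} R} (hG : GPc G) (hfin : Module.Finite R G) :
    ∃ (F G' : ModuleCat.{0} R) (i : G →ₗ[R] F) (p : F →ₗ[R] G'),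
      Module.Projective R F ∧ Module.Finite R F ∧ Ses i p ∧ GPc G' := by
  classical
  obtain ⟨ι, C, j, q, hs, hC⟩ := hG.step_free
  let j : G →ₗ[R] (ι →₀ R) := j
  obtain ⟨S, hS⟩ := hfin.fg_top
  let t : Finset ι := S.biUnion (fun x => (j x).support)
  have hj : ∀ x, j x ∈ Finsupp.supported R R (t : Set ι) := by
    intro x
    have : (⊤ : Submodule R G) ≤ (Finsupp.supported R R (t : Set ι)).comap j := by
      rw [← hS, Submodule.span_le]
      intro y hy
      change j y ∈ Finsupp.supported R R (t : Set ι)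
      rw [Finsupp.mem_supported]
      exact_mod_cast Finset.subset_biUnion_of_mem (fun x => (j x).support) hy
    exact this trivial
  let F := Finsupp.supported R R (t : Set ι)
  let e := Finsupp.supportedEquivFinsupp (M := R) (R := R) (t : Set ι)
  let e' := Finsupp.supportedEquivFinsupp (M := R) (R := R) ((t : Set ι)ᶜ)
  have hF : Module.Projective R F := Module.Projective.of_equiv e.symm
  have hFf : Module.Finite R F := Module.Finite.equiv e.symm
  let k : G →ₗ[R] F := j.codRestrict F hj
  let r : (ι →₀ R) →ₗ[R] (((t : Set ι)ᶜ : Set ι) →₀ R) := Finsupp.lsubtypeDomain _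
  have hr : Ses (A := ModuleCat.of R F) (B := ModuleCat.of R (ι →₀ R))
      (C := ModuleCat.of R (((t : Set ι)ᶜ : Set ι) →₀ R)) F.subtype r := by
    refine ⟨Subtype.val_injective, ?_, ?_⟩
    · intro y
      refine ⟨e'.symm y, ?_⟩
      exact e'.apply_symm_apply y
    · intro x
      constructor
      · intro hx
        refine ⟨⟨x, ?_⟩, rfl⟩
        rw [Finsupp.mem_supported']
        intro a ha
        exact DFunLike.congr_fun hx (⟨a, ha⟩ : ((t : Set ι)ᶜ : Set ι))
      · rintro ⟨⟨x, hx⟩, rfl⟩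
        ext ⟨a, ha⟩
        exact (Finsupp.mem_supported' R x).1 hx a ha
  obtain ⟨a, b, hab⟩ := third_iso hs hr k (fun x => rfl)
  have hk : Function.Injective k := fun x y hxy => hs.inj (congrArg Subtype.val hxy)
  refine ⟨ModuleCat.of R F, _, k, _, hF, hFf, ses_of_inj (C := ModuleCat.of R F) k hk,
    GPc.kernel hab hC (GPc.of_proj ?_)⟩
  change Module.Projective R (((t : Set ι)ᶜ : Set ι) →₀ R)
  infer_instance

theorem fp_of_fg_sub (hc : IsCoherentRing R) : ∀ (n : ℕ) (N : Submodule R (Fin n → R)),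
    N.FG → Module.FinitePresentation R N := by
  intro n
  induction n with
  | zero =>
    intro N _
    have : Subsingleton N := inferInstance
    infer_instance
  | succ n ih =>
    intro N hN
    have : Module.Finite R N := Module.Finite.iff_fg.2 hN
    let l : N →ₗ[R] R := (LinearMap.proj 0).comp N.subtype
    have hI : (LinearMap.range l).FG := Module.Finite.iff_fg.1 inferInstance
    have hI' : Module.FinitePresentation R (LinearMap.range l) := hc _ hI
    have hker := Module.FinitePresentation.fg_ker l.rangeRestrict l.surjective_rangeRestrict
    let s : LinearMap.ker l.rangeRestrict →ₗ[R] (Fin n → R) :=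
      (LinearMap.funLeft R R Fin.succ).comp (N.subtype.comp (LinearMap.ker l.rangeRestrict).subtype)
    have hs : Function.Injective s := by
      rw [injective_iff_map_eq_zero]
      rintro ⟨⟨x, hx⟩, hx2⟩ h0
      have h1 : x 0 = 0 := congrArg Subtype.val hx2
      apply Subtype.ext
      apply Subtype.ext
      funext i
      refine Fin.cases h1 (fun i => ?_) i
      exact congrFun h0 i
    have : Module.Finite R (LinearMap.ker l.rangeRestrict) := Module.Finite.iff_fg.2 hker
    have hsr : (LinearMap.range s).FG := Module.Finite.iff_fg.1 inferInstance
    have := ih _ hsr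
    have : Module.FinitePresentation R (LinearMap.ker l.rangeRestrict) :=
      Module.FinitePresentation.of_equiv (R := R) (M := LinearMap.range s)
        (N := LinearMap.ker l.rangeRestrict) (LinearEquiv.ofInjective s hs).symm
    exact Module.finitePresentation_of_ker l.rangeRestrict l.surjective_rangeRestrict

theorem gpdLE_prod {P : ModuleCat.{0} R} (hP : Module.Projective R P) (n : ℕ) :
    ∀ K : ModuleCat.{0} R, gpdLE R n K → gpdLE R n (ModuleCat.of R (K × P)) := by
  cases n with
  | zero =>
    intro K hK
    exact (GPc.prod (GPc_of_IsGProj hK) (GPc.of_proj hP)).isGProj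
  | succ n =>
    rintro K ⟨K', G, f, g, hG, hf, hg, hfg, hK'⟩
    refine ⟨K', ModuleCat.of R (G × P), (LinearMap.inl R G P).comp f, g.prodMap LinearMap.id,
      (GPc.prod (GPc_of_IsGProj hG) (GPc.of_proj hP)).isGProj,
      LinearMap.inl_injective.comp hf, hg.prodMap Function.surjective_id, ?_, hK'⟩
    rintro ⟨x, y⟩
    constructor
    · intro hx
      have h1 : g x = 0 := congrArg Prod.fst hx
      have h2 : y = 0 := congrArg Prod.snd hx
      obtain ⟨z, rfl⟩ := (hfg x).1 h1
      exact ⟨z, Prod.ext rfl h2.symm⟩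
    · rintro ⟨z, hz⟩
      have h1 : f z = x := congrArg Prod.fst hz
      have h2 : 0 = y := congrArg Prod.snd hz
      subst h1 h2
      exact Prod.ext (hfg.apply_apply_eq_zero z) rfl

theorem gpdLE_ker {L E G : ModuleCat.{0} R} {f : L →ₗ[R] E} {g : E →ₗ[R] G} (h : Ses f g)
    (hG : GPc G) (n : ℕ) (hE : gpdLE R n E) : gpdLE R n L := by
  cases n with
  | zero => exact (GPc.kernel h (GPc_of_IsGProj hE) hG).isGProj
  | succ n =>
    obtain ⟨K, G', i, q, hG', hi, hq, hiq, hK⟩ := hE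
    have hs := ses_of_surj (g.comp q) (h.surj.comp hq)
    have hH := GPc.kernel hs (GPc_of_IsGProj hG') hG
    let H := LinearMap.ker (g.comp q)
    let a : K →ₗ[R] H := i.codRestrict H (fun x => by
      simp [H, hiq.apply_apply_eq_zero])
    obtain ⟨b, hb⟩ := exists_colift f h.inj (q.comp H.subtype) (fun x => (h.exact _).1 x.2)
    refine ⟨K, ModuleCat.of R H, a, b, hH.isGProj,
      fun x y hxy => hi (congrArg Subtype.val hxy), ?_, ?_, hK⟩
    · intro x
      obtain ⟨y, hy⟩ := hq (f x)
      have hy' : y ∈ H := by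
        change g (q y) = 0
        rw [hy, h.exact.apply_apply_eq_zero]
      refine ⟨⟨y, hy'⟩, h.inj ?_⟩
      rw [hb]; exact hy
    · intro x
      have hb' : f (b x) = q x.1 := hb x
      constructor
      · intro hx
        rw [hx, map_zero] at hb'
        obtain ⟨z, hz⟩ := (hiq _).1 hb'.symm
        exact ⟨z, Subtype.ext hz⟩
      · rintro ⟨z, rfl⟩
        apply h.inj
        rw [hb', map_zero]
        exact hiq.apply_apply_eq_zero z

theorem gpdLE_syz {L P M : ModuleCat.{0} R} {i : L →ₗ[R] P} {p : P →ₗ[R] M} (h : Ses i p)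
    (hP : Module.Projective R P) (n : ℕ) (hM : gpdLE R (n + 1) M) : gpdLE R n L := by
  obtain ⟨K, G, f, q, hG, hf, hq, hfq, hK⟩ := hM
  obtain ⟨l, hl⟩ := Module.projective_lifting_property q p hq
  have hl : ∀ x, q (l x) = p x := fun x => congrArg (fun l => l x) hl
  obtain ⟨c, hc⟩ := exists_colift f hf (-(l.comp i)) (fun x => (hfq _).1 (by
    simp [hl, h.exact.apply_apply_eq_zero]))
  have hc : ∀ x, f (c x) = - l (i x) := hc
  refine gpdLE_ker (E := ModuleCat.of R (K × P)) (G := G) (f := c.prod i)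
    (g := f.coprod l) ⟨?_, ?_, ?_⟩ (GPc_of_IsGProj hG) n (gpdLE_prod hP n K hK)
  · intro x y hxy
    exact h.inj (congrArg Prod.snd hxy)
  · intro x
    obtain ⟨y, hy⟩ := h.surj (q x)
    obtain ⟨z, hz⟩ := (hfq (x - l y)).1 (by simp [hl, hy])
    refine ⟨(z, y), ?_⟩
    simp [hz]
  · rintro ⟨x, y⟩
    constructor
    · intro hxy
      have hxy : f x + l y = 0 := hxy
      have h1 : p y = 0 := by
        have := congrArg q hxy
        simpa [hl, hfq.apply_apply_eq_zero] using this
      obtain ⟨z, rfl⟩ := (h.exact _).1 h1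
      refine ⟨z, Prod.ext (hf ?_) rfl⟩
      change f (c z) = f x
      rw [hc]
      exact (eq_neg_of_add_eq_zero_left hxy).symm
    · rintro ⟨z, hz⟩
      have h1 : c z = x := congrArg Prod.fst hz
      have h2 : i z = y := congrArg Prod.snd hz
      subst h1 h2
      change f (c z) + l (i z) = 0
      rw [hc]; simp

/-- `K = 0`, or projective dimension at most `n - 1` -/
def CC : ℕ → ModuleCat.{0} R → Prop
  | 0, K => Subsingleton K
  | n + 1, K => pdLE R n K

theorem CC_succ {K F D : ModuleCat.{0} R} {i : K →ₗ[R] F} {p : F →ₗ[R] D} (h : Ses i p)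
    (hF : Module.Projective R F) (n : ℕ) (hK : CC n K) : CC (n + 1) D := by
  cases n with
  | zero =>
    have hK : Subsingleton K := hK
    have hi : Function.Injective p := by
      rw [injective_iff_map_eq_zero]
      intro x hx
      obtain ⟨y, rfl⟩ := (h.exact x).1 hx
      rw [Subsingleton.elim y 0, map_zero]
    exact Module.Projective.of_equiv (LinearEquiv.ofBijective p ⟨hi, h.surj⟩)
  | succ n => exact ⟨K, F, i, p, hF, h.inj, h.surj, h.exact, hK⟩

theorem main_aux (hc : IsCoherentRing R) (n : ℕ) : ∀ M : ModuleCat.{0} R,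
    Module.FinitePresentation R M → gpdLE R n M →
    ∃ (K G : ModuleCat.{0} R) (f : K →ₗ[R] G) (g : G →ₗ[R] M),
      Module.Finite R G ∧ GPc G ∧ Module.FinitePresentation R K ∧ CC n K ∧ Ses f g := by
  induction n with
  | zero =>
    intro M hM hG
    refine ⟨ModuleCat.of R PUnit, M, 0, LinearMap.id, inferInstance, GPc_of_IsGProj hG, ?_, ?_,
      ⟨?_, Function.surjective_id, ?_⟩⟩
    · change Module.FinitePresentation R PUnit
      infer_instance
    · change Subsingleton PUnit
      infer_instance
    · intro x y _
      rfl
    · intro x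
      constructor
      · intro hx
        exact ⟨0, hx.symm⟩
      · rintro ⟨y, rfl⟩
        rfl
  | succ n ih =>
    intro M hM hG
    obtain ⟨m, π, hπ⟩ := Module.Finite.exists_fin' R M
    let P : ModuleCat.{0} R := ModuleCat.of R (Fin m → R)
    let π : P →ₗ[R] M := π
    have hP : Module.Projective R P := by
      change Module.Projective R (Fin m → R)
      infer_instance
    have hPf : Module.Finite R P := by
      change Module.Finite R (Fin m → R)
      infer_instance
    have hsL := ses_of_surj π hπ
    have hL := gpdLE_syz hsL hP n hG
    have hLf : Module.FinitePresentation R (LinearMap.ker π) :=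
      fp_of_fg_sub hc m _ (Module.FinitePresentation.fg_ker π hπ)
    obtain ⟨K, G, f, g, hGf, hGG, hK, hCK, hs⟩ := ih _ hLf hL
    obtain ⟨F, G', i, p, hF, hFf, hsF, hG'⟩ := hGG.step_fin hGf
    obtain ⟨φ, hφ⟩ := hsF.extend (hG'.ev P hP 0) ((LinearMap.ker π).subtype.comp g)
    have hφ : ∀ x, φ (i x) = (LinearMap.ker π).subtype (g x) :=
      fun x => congrArg (fun l => l x) hφ
    have hπφ : ∀ x, π (φ (i x)) = 0 := fun x => by rw [hφ]; exact (g x).2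
    obtain ⟨θ, hθ⟩ := exists_factor p hsF.surj (π.comp φ) (by
      intro x hx
      obtain ⟨y, rfl⟩ := (hsF.exact x).1 hx
      exact hπφ y)
    have hθ : ∀ x, θ (p x) = π (φ x) := hθ
    have hG'f : Module.Finite R G' := Module.Finite.of_surjective p hsF.surj
    let Φ : F →ₗ[R] P × G' := φ.prod p
    let ψ : P × G' →ₗ[R] M := π.coprod (-θ)
    have hψ : ∀ x y, ψ (x, y) = π x - θ y := fun x y => by simp [ψ, sub_eq_add_neg]
    have hD : Ses (A := K) (B := F) (C := ModuleCat.of R (LinearMap.range Φ)) (i.comp f)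
        Φ.rangeRestrict := by
      refine ⟨hsF.inj.comp hs.inj, Φ.surjective_rangeRestrict, ?_⟩
      intro x
      constructor
      · intro hx
        have hx : Φ x = 0 := congrArg Subtype.val hx
        have h1 : φ x = 0 := congrArg Prod.fst hx
        have h2 : p x = 0 := congrArg Prod.snd hx
        obtain ⟨y, rfl⟩ := (hsF.exact x).1 h2
        rw [hφ] at h1
        have h3 : g y = 0 := Subtype.ext h1
        obtain ⟨z, rfl⟩ := (hs.exact y).1 h3
        exact ⟨z, rfl⟩
      · rintro ⟨z, rfl⟩
        apply Subtype.ext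
        change Φ (i (f z)) = 0
        refine Prod.ext ?_ (hsF.exact.apply_apply_eq_zero _)
        change φ (i (f z)) = 0
        rw [hφ, hs.exact.apply_apply_eq_zero, map_zero]
    refine ⟨ModuleCat.of R (LinearMap.range Φ), ModuleCat.of R (P × G'),
      (LinearMap.range Φ).subtype, ψ, ?_, GPc.prod (GPc.of_proj hP) hG', ?_,
      CC_succ hD hF n hCK, ⟨Subtype.val_injective, ?_, ?_⟩⟩
    · change Module.Finite R (P × G')
      infer_instance
    · have := Module.finitePresentation_of_projective R F
      refine Module.finitePresentation_of_surjective Φ.rangeRestrict Φ.surjective_rangeRestrict ?_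
      have e : LinearMap.ker Φ.rangeRestrict = LinearMap.range (i.comp f) := by
        ext x
        exact hD.exact x
      rw [e]
      exact Module.Finite.iff_fg.1 inferInstance
    · intro x
      obtain ⟨y, rfl⟩ := hπ x
      exact ⟨(y, 0), by rw [hψ]; simp [π]⟩
    · rintro ⟨x, y⟩
      rw [hψ]
      constructor
      · intro hx
        obtain ⟨z, rfl⟩ := hsF.surj y
        rw [hθ, ← map_sub] at hx
        obtain ⟨w, hw⟩ := hs.surj ⟨x - φ z, hx⟩
        have hw' : φ (i w) = x - φ z := by
          rw [hφ, hw]; rfl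
        refine ⟨⟨_, z + i w, rfl⟩, ?_⟩
        refine Prod.ext ?_ ?_
        · change φ (z + i w) = x
          rw [map_add, hw']; abel
        · change p (z + i w) = p z
          rw [map_add, hsF.exact.apply_apply_eq_zero, add_zero]
      · rintro ⟨⟨_, z, rfl⟩, hz⟩
        have h1 : φ z = x := congrArg Prod.fst hz
        have h2 : p z = y := congrArg Prod.snd hz
        rw [← h1, ← h2, hθ, sub_self]

theorem gpdLE_of_pdLE (n : ℕ) : ∀ K : ModuleCat.{0} R, pdLE R n K → gpdLE R n K := by
  induction n with
  | zero => exact fun K hK => (GPc.of_proj hK).isGProj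
  | succ n ih =>
    rintro K ⟨K', G, f, g, hG, hf, hg, hfg, hK'⟩
    exact ⟨K', G, f, g, (GPc.of_proj hG).isGProj, hf, hg, hfg, ih _ hK'⟩

theorem gpdLE_of_gpd {M : ModuleCat.{0} R} {n : ℕ} (h : gpd R M = n) : gpdLE R n M := by
  have h1 : gpd R M < ((n + 1 : ℕ) : ℕ∞) := by rw [h]; exact_mod_cast Nat.lt_succ_self n
  simp only [gpd, iInf_lt_iff] at h1
  obtain ⟨m, hm, hlt⟩ := h1
  have h2 : gpd R M ≤ m := iInf₂_le m hm
  rw [h] at h2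
  have h3 : n ≤ m := by exact_mod_cast h2
  have h4 : m < n + 1 := by exact_mod_cast hlt
  rwa [show n = m by omega]

end
end GW

/-- over a coherent ring, a finitely presented module of finite Gorenstein
projective dimension `n > 0` fits in a short exact sequence `0 → K → G → M → 0` with `G`
finitely generated Gorenstein projective and `K` finitely presented of projective
dimension `n - 1`. -/
theorem stmt19 (R : Type) [CommRing R] (hc : GW.IsCoherentRing R) (M : ModuleCat.{0} R)
    (hfp : Module.FinitePresentation R M) (n : ℕ) (hn : 0 < n)
    (h : GW.gpd R M = n) :
    ∃ (K G : ModuleCat.{0} R) (f : K →ₗ[R] G) (g : G →ₗ[R] M),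
      Module.Finite R G ∧ GW.IsGProj R G ∧ Module.FinitePresentation R K ∧
      GW.pd R K = ((n - 1 : ℕ) : ℕ∞) ∧
      Function.Injective f ∧ Function.Surjective g ∧ Function.Exact f g := by
  obtain ⟨m, rfl⟩ : ∃ m, n = m + 1 := ⟨n - 1, by omega⟩
  obtain ⟨K, G, f, g, hGf, hG, hK, hCK, hs⟩ :=
    GW.main_aux hc (m + 1) M hfp (GW.gpdLE_of_gpd h)
  refine ⟨K, G, f, g, hGf, hG.isGProj, hK, ?_, hs.inj, hs.surj, hs.exact⟩
  rw [Nat.add_sub_cancel]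
  apply le_antisymm
  · exact iInf₂_le m hCK
  · refine le_iInf₂ fun k hk => ?_
    have h1 : GW.gpdLE R (k + 1) M :=
      ⟨K, G, f, g, hG.isGProj, hs.inj, hs.surj, hs.exact, GW.gpdLE_of_pdLE k K hk⟩
    have h2 : GW.gpd R M ≤ ((k + 1 : ℕ) : ℕ∞) := iInf₂_le (k + 1) h1
    rw [h] at h2
    have h3 : m + 1 ≤ k + 1 := by exact_mod_cast h2
    exact_mod_cast Nat.le_of_succ_le_succ h3
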